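/- For the acceptance modes (σ,ρ) ∈ {(ran,⊓), (ran,=)}, the family of ω-languages (σ,ρ,l)-accepted by context-sensitive ω-grammars is included in the family of ω-languages (σ,ρ,l)-accepted by context-free ω-grammars: 𝓛_{σ,ρ,l}(ω-CSG) ⊆ 𝓛_{σ,ρ,l}(ω-CFG). -/

import Mathlib

namespace OmegaFormal

/-- σ component of an acceptance mode: `ran` (occurs at least once)
or `inf` (occurs infinitely often). -/
inductive AccSigma | ran | inf
deriving DecidableEq

/-- ρ component of an acceptance mode: `cap` (nonempty intersection, ⊓),
`sub` (⊆) or `eq` (=). -/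
inductive AccRho | cap | sub | eq
deriving DecidableEq

/-- derivation mode: leftmost (`l`) or normal (`nl`). -/
inductive DerivMode | l | nl
deriving DecidableEq

/-- `sigmaSet σ f` is ran(f) resp. inf(f). -/
def sigmaSet {Q : Type _} : AccSigma → (ℕ → Q) → Set Q
  | .ran, f => Set.range f
  | .inf, f => {q | ∀ n : ℕ, ∃ m : ℕ, n ≤ m ∧ f m = q}

/-- the binary relation denoted by ρ. -/
def rhoRel {Q : Type _} : AccRho → Set Q → Set Q → Prop
  | .cap, A, B => (A ∩ B).Nonempty
  | .sub, A, B => A ⊆ B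
  | .eq,  A, B => A = B

/-- f is (σ,ρ)-accepting w.r.t. the set 𝓕 of designated sets. -/
def IsAccepting {Q : Type _} (σ : AccSigma) (ρ : AccRho) (𝓕 : Set (Set Q)) (f : ℕ → Q) : Prop :=
  ∃ F ∈ 𝓕, rhoRel ρ (sigmaSet σ f) F

/-- the finite word `l` coincides with the prefix of the ω-word `u`. -/
def MatchesPrefix {T : Type _} (l : List T) (u : ℕ → T) : Prop :=
  ∀ (k : ℕ) (h : k < l.length), l.get ⟨k, h⟩ = u k

/-- the maximal terminal prefix of a sentential form. -/
def termPrefix {N T : Type _} : List (N ⊕ T) → List T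
  | [] => []
  | (Sum.inl _) :: _ => []
  | (Sum.inr a) :: l => a :: termPrefix l

/-- A phrase structure ω-grammar `G = (N, T, P, S, 𝓕)`:
`N` nonterminals, `T` terminals, `P` named productions `p : lhs p → rhs p`
with `lhs p ∈ N⁺`, `rhs p ∈ (N ∪ T)*`, start symbol, and
production repetition sets `acc ⊆ 2^P`. -/
structure OmegaPSG (T : Type) where
  N : Type
  [fintypeN : Fintype N]
  P : Type
  [fintypeP : Fintype P]
  lhs : P → List N
  lhs_ne : ∀ p : P, lhs p ≠ []
  rhs : P → List (N ⊕ T)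
  start : N
  acc : Set (Set P)

namespace OmegaPSG

variable {T : Type} (G : OmegaPSG T)

/-- one (normal) rewriting step using production p. -/
def Step (p : G.P) (x y : List (G.N ⊕ T)) : Prop :=
  ∃ u v : List (G.N ⊕ T),
    x = u ++ (G.lhs p).map Sum.inl ++ v ∧ y = u ++ G.rhs p ++ v

/-- one leftmost rewriting step: the rewritten occurrence starts at the
leftmost nonterminal, i.e. everything to its left is terminal. -/
def LStep (p : G.P) (x y : List (G.N ⊕ T)) : Prop :=
  ∃ u v : List (G.N ⊕ T), (∀ s ∈ u, ∃ a : T, s = Sum.inr a) ∧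
    x = u ++ (G.lhs p).map Sum.inl ++ v ∧ y = u ++ G.rhs p ++ v

def StepOf : DerivMode → G.P → List (G.N ⊕ T) → List (G.N ⊕ T) → Prop
  | .l => G.LStep
  | .nl => G.Step

/-- `L_{σ,ρ,π}(G)`: ω-words admitting an infinite π-derivation from S whose
growing terminal prefixes spell the word and whose production sequence is
(σ,ρ)-accepting w.r.t. `G.acc`. -/
def Lang (σ : AccSigma) (ρ : AccRho) (π : DerivMode) : Set (ℕ → T) :=
  {u | ∃ (s : ℕ → List (G.N ⊕ T)) (d : ℕ → G.P),
    s 0 = [Sum.inl G.start] ∧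
    (∀ i : ℕ, G.StepOf π (d i) (s i) (s (i + 1))) ∧
    (∀ n : ℕ, ∃ i : ℕ, n ≤ (termPrefix (s i)).length) ∧
    (∀ i : ℕ, MatchesPrefix (termPrefix (s i)) u) ∧
    IsAccepting σ ρ G.acc d}

/-- context-free: every left-hand side is a single nonterminal. -/
def IsCFG : Prop := ∀ p : G.P, (G.lhs p).length = 1

/-- context-sensitive (monotonic): `|β| ≥ |α|` for every production. -/
def IsCSG : Prop := ∀ p : G.P, (G.lhs p).length ≤ (G.rhs p).length

/-- right linear: productions of the form `A → uB` or `A → u`, `u ∈ T*`. -/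
def IsRLG : Prop :=
  ∀ p : G.P, (G.lhs p).length = 1 ∧
    ∃ (w : List T) (B : Option G.N),
      G.rhs p = w.map Sum.inr ++ B.toList.map Sum.inl

/-- `G` is a grammar with `$`-boundary (PSG version): with `$` = `dollar`,
`S` = `S'`, every production has one of the forms
(1) α → β, α,β ∈ N⁺ (N = nonterminals other than `$`, `S`),
(2) S → $α, α ∈ N⁺, (3) $A → a$, (4) A → ε. -/
def HasDollarBoundary (dollar S' : G.N) : Prop :=
  dollar ≠ S' ∧ G.start = S' ∧
  ∀ p : G.P,
    ((dollar ∉ G.lhs p ∧ S' ∉ G.lhs p) ∧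
      ∃ β : List G.N, β ≠ [] ∧ dollar ∉ β ∧ S' ∉ β ∧ G.rhs p = β.map Sum.inl) ∨
    (G.lhs p = [S'] ∧ ∃ α : List G.N, α ≠ [] ∧ dollar ∉ α ∧ S' ∉ α ∧
      G.rhs p = Sum.inl dollar :: α.map Sum.inl) ∨
    (∃ A : G.N, A ≠ dollar ∧ A ≠ S' ∧ G.lhs p = [dollar, A] ∧
      ∃ a : T, G.rhs p = [Sum.inr a, Sum.inl dollar]) ∨
    (∃ A : G.N, A ≠ dollar ∧ A ≠ S' ∧ G.lhs p = [A] ∧ G.rhs p = [])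

/-- `G` is a grammar with `$`-boundary (CSG version): forms (1)-(3) only,
with `|α| ≤ |β|` in form (1). -/
def HasDollarBoundaryCSG (dollar S' : G.N) : Prop :=
  dollar ≠ S' ∧ G.start = S' ∧
  ∀ p : G.P,
    ((dollar ∉ G.lhs p ∧ S' ∉ G.lhs p) ∧
      ∃ β : List G.N, β ≠ [] ∧ dollar ∉ β ∧ S' ∉ β ∧ (G.lhs p).length ≤ β.length ∧
        G.rhs p = β.map Sum.inl) ∨
    (G.lhs p = [S'] ∧ ∃ α : List G.N, α ≠ [] ∧ dollar ∉ α ∧ S' ∉ α ∧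
      G.rhs p = Sum.inl dollar :: α.map Sum.inl) ∨
    (∃ A : G.N, A ≠ dollar ∧ A ≠ S' ∧ G.lhs p = [dollar, A] ∧
      ∃ a : T, G.rhs p = [Sum.inr a, Sum.inl dollar])

end OmegaPSG

/-- `𝓛_{σ,ρ,π}(X)` for the family `X` of ω-grammars over `T` satisfying `C`. -/
def GLang (T : Type) (C : OmegaPSG T → Prop) (σ : AccSigma) (ρ : AccRho) (π : DerivMode) :
    Set (Set (ℕ → T)) :=
  {L | ∃ G : OmegaPSG T, C G ∧ L = G.Lang σ ρ π}

/-- number of non-ε labels among `b 0, …, b (i-1)`. -/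
def someCount {A : Type _} (b : ℕ → Option A) (i : ℕ) : ℕ :=
  ((Finset.range i).filter fun j => (b j).isSome = true).card

/-- the (ε-allowing) label sequence `b` concatenates to the ω-word `u`. -/
def Spells {A : Type _} (b : ℕ → Option A) (u : ℕ → A) : Prop :=
  (∀ n : ℕ, ∃ i : ℕ, n ≤ someCount b i) ∧
  ∀ i : ℕ, ∀ a : A, b i = some a → a = u (someCount b i)

/-- A finite state ω-automaton `(Q, Σ, δ, q₀, 𝓕)`. -/
structure OmegaFSA (Sig : Type) where
  Q : Type
  [fintypeQ : Fintype Q]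
  init : Q
  trans : Q → Option Sig → Q → Prop
  acc : Set (Set Q)

/-- `L_{σ,ρ}(A)` for a finite state ω-automaton. -/
def OmegaFSA.Lang {Sig : Type} (A : OmegaFSA Sig) (σ : AccSigma) (ρ : AccRho) :
    Set (ℕ → Sig) :=
  {u | ∃ (r : ℕ → A.Q) (b : ℕ → Option Sig),
    r 0 = A.init ∧ (∀ i : ℕ, A.trans (r i) (b i) (r (i + 1))) ∧
    Spells b u ∧ IsAccepting σ ρ A.acc r}

/-- `𝓛_{σ,ρ}(ω-FSA)`. -/
def FSALang (Sig : Type) (σ : AccSigma) (ρ : AccRho) : Set (Set (ℕ → Sig)) :=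
  {L | ∃ A : OmegaFSA Sig, L = A.Lang σ ρ}

/-- A pushdown ω-automaton `(Q, Σ, Γ, δ, q₀, Z₀, 𝓕)`. -/
structure OmegaPDA (Sig : Type) where
  Q : Type
  [fintypeQ : Fintype Q]
  Γ : Type
  [fintypeΓ : Fintype Γ]
  init : Q
  Z0 : Γ
  trans : Q → Option Sig → Γ → Q → List Γ → Prop
  acc : Set (Set Q)

/-- `L_{σ,ρ}(D)` for a pushdown ω-automaton. -/
def OmegaPDA.Lang {Sig : Type} (D : OmegaPDA Sig) (σ : AccSigma) (ρ : AccRho) :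
    Set (ℕ → Sig) :=
  {u | ∃ (q : ℕ → D.Q) (st : ℕ → List D.Γ) (b : ℕ → Option Sig),
    q 0 = D.init ∧ st 0 = [D.Z0] ∧
    (∀ i : ℕ, ∃ (Z : D.Γ) (γ rest : List D.Γ),
      st i = Z :: rest ∧ D.trans (q i) (b i) Z (q (i + 1)) γ ∧ st (i + 1) = γ ++ rest) ∧
    Spells b u ∧ IsAccepting σ ρ D.acc q}

/-- `𝓛_{σ,ρ}(ω-PDA)`. -/
def PDALang (Sig : Type) (σ : AccSigma) (ρ : AccRho) : Set (Set (ℕ → Sig)) :=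
  {L | ∃ D : OmegaPDA Sig, L = D.Lang σ ρ}

/-- tape head moves. -/
inductive Move | L | R | S
deriving DecidableEq

def moveHead : Move → ℕ → ℕ
  | .L, n => n - 1
  | .R, n => n + 1
  | .S, n => n

/-- A single-tape Turing ω-machine `(Q, Σ, Γ, δ, q₀, 𝓕)` (Σ ⊆ Γ via `embed`). -/
structure OmegaTM (Sig : Type) where
  Q : Type
  [fintypeQ : Fintype Q]
  Γ : Type
  [fintypeΓ : Fintype Γ]
  embed : Sig → Γ
  embed_inj : Function.Injective embed
  init : Q
  trans : Q → Γ → Q → Γ → Move → Prop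
  acc : Set (Set Q)

/-- `L_{σ,ρ}(M)`: ω-words admitting a complete non-oscillating run whose state
sequence is (σ,ρ)-accepting. -/
def OmegaTM.Lang {Sig : Type} (M : OmegaTM Sig) (σ : AccSigma) (ρ : AccRho) :
    Set (ℕ → Sig) :=
  {u | ∃ (q : ℕ → M.Q) (tape : ℕ → ℕ → M.Γ) (pos : ℕ → ℕ),
    q 0 = M.init ∧ (∀ n : ℕ, tape 0 n = M.embed (u n)) ∧ pos 0 = 0 ∧
    (∀ i : ℕ, ∃ (g : M.Γ) (m : Move),
      M.trans (q i) (tape i (pos i)) (q (i + 1)) g m ∧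
      tape (i + 1) = Function.update (tape i) (pos i) g ∧
      pos (i + 1) = moveHead m (pos i)) ∧
    (∀ n : ℕ, ∃ i : ℕ, n ≤ pos i) ∧
    (∀ n : ℕ, ∃ i0 : ℕ, ∀ i : ℕ, i0 ≤ i → pos i ≠ n) ∧
    IsAccepting σ ρ M.acc q}

/-- `𝓛_{σ,ρ}(ω-TM)`. -/
def TMLang (Sig : Type) (σ : AccSigma) (ρ : AccRho) : Set (Set (ℕ → Sig)) :=
  {L | ∃ M : OmegaTM Sig, L = M.Lang σ ρ}

/-- An m-tape Turing ω-machine. -/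
structure OmegaMTM (m : ℕ) (Sig : Type) where
  Q : Type
  [fintypeQ : Fintype Q]
  Γ : Type
  [fintypeΓ : Fintype Γ]
  embed : Sig → Γ
  embed_inj : Function.Injective embed
  blank : Γ
  init : Q
  trans : Q → (Fin m → Γ) → Q → (Fin m → Γ) → (Fin m → Move) → Prop
  acc : Set (Set Q)

/-- `L_{σ,ρ}(M)` for an m-tape Turing ω-machine (`hm : 0 < m`; the input is on
the first tape, the other tapes are initially blank; the run must be complete
and non-oscillating on the first tape). -/
def OmegaMTM.Lang {m : ℕ} {Sig : Type} (M : OmegaMTM m Sig) (hm : 0 < m)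
    (σ : AccSigma) (ρ : AccRho) : Set (ℕ → Sig) :=
  {u | ∃ (q : ℕ → M.Q) (tape : ℕ → Fin m → ℕ → M.Γ) (pos : ℕ → Fin m → ℕ),
    q 0 = M.init ∧
    (∀ n : ℕ, tape 0 ⟨0, hm⟩ n = M.embed (u n)) ∧
    (∀ j : Fin m, j ≠ ⟨0, hm⟩ → ∀ n : ℕ, tape 0 j n = M.blank) ∧
    (∀ j : Fin m, pos 0 j = 0) ∧
    (∀ i : ℕ, ∃ (g : Fin m → M.Γ) (mv : Fin m → Move),
      M.trans (q i) (fun j => tape i j (pos i j)) (q (i + 1)) g mv ∧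
      (∀ j : Fin m, tape (i + 1) j = Function.update (tape i j) (pos i j) (g j)) ∧
      (∀ j : Fin m, pos (i + 1) j = moveHead (mv j) (pos i j))) ∧
    (∀ n : ℕ, ∃ i : ℕ, n ≤ pos i ⟨0, hm⟩) ∧
    (∀ n : ℕ, ∃ i0 : ℕ, ∀ i : ℕ, i0 ≤ i → pos i ⟨0, hm⟩ ≠ n) ∧
    IsAccepting σ ρ M.acc q}

/-- `𝓛_{σ,ρ}(m-ω-TM)`. -/
def MTMLang (Sig : Type) (m : ℕ) (hm : 0 < m) (σ : AccSigma) (ρ : AccRho) :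
    Set (Set (ℕ → Sig)) :=
  {L | ∃ M : OmegaMTM m Sig, L = M.Lang hm σ ρ}

/-- the ω-language `{aⁿbⁿ | n ≥ 1}^ω` over the alphabet `Bool`
(`false` = a, `true` = b). -/
def abLang : Set (ℕ → Bool) :=
  {u | ∃ n : ℕ → ℕ, (∀ i : ℕ, 1 ≤ n i) ∧
    ∀ i k : ℕ, k < 2 * n i →
      u ((∑ j ∈ Finset.range i, 2 * n j) + k) = decide (n i ≤ k)}

end OmegaFormal
open OmegaFormal

namespace OmegaFormal

attribute [local instance] OmegaPSG.fintypeN OmegaPSG.fintypeP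

/-- Nonterminal words of length at most `K`: the word of nonterminals already consumed on the way
to a left-hand side. -/
abbrev Buffer (N : Type) (K : ℕ) : Type := {w : List N // w.length ≤ K}

/-- A nonterminal annotated with the buffer when it becomes leftmost and the buffer guessed for the
moment when everything derived from it has been consumed. -/
abbrev AnnSymbol (N : Type) (K : ℕ) : Type := N × Buffer N K × Buffer N K

section Annotation

variable {N T : Type} {K : ℕ}

/-- `Chain w c w'`: the annotations in `c` fit together, leading from buffer `w` to buffer `w'`,
and terminals are passed with empty buffer only. -/
def Chain : List N → List (AnnSymbol N K ⊕ T) → List N → Prop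
  | w, [], w' => w = w'
  | w, Sum.inl B :: c, w' => B.2.1.1 = w ∧ Chain B.2.2.1 c w'
  | w, Sum.inr _ :: c, w' => w = [] ∧ Chain [] c w'

/-- Forget the annotations. -/
def erase (c : List (AnnSymbol N K ⊕ T)) : List (N ⊕ T) :=
  c.map (Sum.map Prod.fst id)

/-- Annotate a sentential form; `q m` is the buffer in front of the suffix of length `m`. -/
def annotate (q : ℕ → Buffer N K) : List (N ⊕ T) → List (AnnSymbol N K ⊕ T)
  | [] => []
  | Sum.inl A :: l => Sum.inl (A, q (l.length + 1), q l.length) :: annotate q l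
  | Sum.inr a :: l => Sum.inr a :: annotate q l

theorem Chain.append {c₁ c₂ : List (AnnSymbol N K ⊕ T)} {w w' w'' : List N}
    (h₁ : Chain w c₁ w') (h₂ : Chain w' c₂ w'') : Chain w (c₁ ++ c₂) w'' := by
  induction c₁ generalizing w with
  | nil => cases h₁; exact h₂
  | cons x c ih => rcases x with B | a <;> exact ⟨h₁.1, ih h₁.2⟩

@[simp] theorem erase_append (c₁ c₂ : List (AnnSymbol N K ⊕ T)) :
    erase (c₁ ++ c₂) = erase c₁ ++ erase c₂ := by simp [erase]

@[simp] theorem erase_cons_inl (B : AnnSymbol N K) (c : List (AnnSymbol N K ⊕ T)) :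
    erase (Sum.inl B :: c) = Sum.inl B.1 :: erase c := rfl

@[simp] theorem erase_annotate (q : ℕ → Buffer N K) (l : List (N ⊕ T)) :
    erase (annotate q l) = l := by
  induction l with
  | nil => rfl
  | cons x l ih => rcases x with A | a <;> simpa [annotate, erase] using ih

theorem annotate_append (q : ℕ → Buffer N K) (l₁ l₂ : List (N ⊕ T)) :
    annotate q (l₁ ++ l₂) = annotate (fun m => q (m + l₂.length)) l₁ ++ annotate q l₂ := by
  induction l₁ with
  | nil => rfl
  | cons x l ih =>
    rcases x with A | a
    · simp [annotate, ih, Nat.add_right_comm]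
    · simp [annotate, ih]

theorem annotate_map_inr (q : ℕ → Buffer N K) (u : List T) :
    annotate q (u.map Sum.inr) = u.map Sum.inr := by
  induction u with
  | nil => rfl
  | cons a u ih => simp [annotate, ih]

theorem annotate_congr {q q' : ℕ → Buffer N K} {l : List (N ⊕ T)}
    (h : ∀ m ≤ l.length, q m = q' m) : annotate q l = annotate q' l := by
  induction l with
  | nil => rfl
  | cons x l ih =>
    have := ih fun m hm => h m (by simp; omega)
    rcases x with A | a
    · simp [annotate, this, h (l.length + 1) (by simp), h l.length (by simp)]
    · simp [annotate, this]

theorem chain_annotate {q : ℕ → Buffer N K} {l : List (N ⊕ T)}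
    (h : ∀ y a l', l = y ++ Sum.inr a :: l' → (q (l'.length + 1)).1 = [] ∧ (q l'.length).1 = []) :
    Chain (q l.length).1 (annotate q l) (q 0).1 := by
  induction l with
  | nil => rfl
  | cons x l ih =>
    have ih := ih fun y a l' hl => h (x :: y) a l' (by simp [hl])
    rcases x with A | a
    · exact ⟨rfl, ih⟩
    · obtain ⟨h₁, h₂⟩ := h [] a l rfl
      exact ⟨h₁, h₂ ▸ ih⟩

theorem exists_map_inr {M : Type} {u : List (M ⊕ T)} (h : ∀ s ∈ u, ∃ a : T, s = Sum.inr a) :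
    ∃ u' : List T, u = u'.map Sum.inr := by
  induction u with
  | nil => exact ⟨[], rfl⟩
  | cons s u ih =>
    obtain ⟨a, rfl⟩ := h _ List.mem_cons_self
    obtain ⟨u', rfl⟩ := ih fun s hs => h s (List.mem_cons_of_mem _ hs)
    exact ⟨a :: u', rfl⟩

theorem termPrefix_map_inr_append {M : Type} (u : List T) (l : List (M ⊕ T)) :
    termPrefix (u.map Sum.inr ++ l) = u ++ termPrefix l := by
  induction u with
  | nil => rfl
  | cons a u ih => simp [termPrefix, ih]

theorem termPrefix_map_inl_append {M : Type} {w : List M} (hw : w ≠ []) (l : List (M ⊕ T)) :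
    termPrefix (w.map Sum.inl ++ l) = [] := by
  cases w with
  | nil => exact absurd rfl hw
  | cons A w => rfl

end Annotation

namespace OmegaPSG

variable {T : Type} (G : OmegaPSG T)

/-- An infinite leftmost derivation `s` with production sequence `d` generating `u`. -/
def LDerives (u : ℕ → T) (s : ℕ → List (G.N ⊕ T)) (d : ℕ → G.P) : Prop :=
  s 0 = [Sum.inl G.start] ∧
    (∀ i : ℕ, G.LStep (d i) (s i) (s (i + 1))) ∧
    (∀ n : ℕ, ∃ i : ℕ, n ≤ (termPrefix (s i)).length) ∧
    (∀ i : ℕ, MatchesPrefix (termPrefix (s i)) u)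

theorem LStep.exists_map_inr {G : OmegaPSG T} {p : G.P} {x y : List (G.N ⊕ T)}
    (h : G.LStep p x y) : ∃ (u : List T) (v : List (G.N ⊕ T)),
      x = u.map Sum.inr ++ ((G.lhs p).map Sum.inl ++ v) ∧ y = u.map Sum.inr ++ (G.rhs p ++ v) := by
  obtain ⟨u, v, hu, rfl, rfl⟩ := h
  obtain ⟨u, rfl⟩ := OmegaFormal.exists_map_inr hu
  exact ⟨u, v, by simp, by simp⟩

theorem LStep.of_map_inr {G : OmegaPSG T} {p : G.P} (u : List T) (v : List (G.N ⊕ T)) :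
    G.LStep p (u.map Sum.inr ++ ((G.lhs p).map Sum.inl ++ v)) (u.map Sum.inr ++ (G.rhs p ++ v)) :=
  ⟨u.map Sum.inr, v, by simp, by simp, by simp⟩

/-- A bound for the lengths of the left-hand sides. -/
def maxLhs : ℕ := Finset.univ.sup fun p => (G.lhs p).length

theorem length_lhs_le (p : G.P) : (G.lhs p).length ≤ G.maxLhs :=
  Finset.le_sup (f := fun p => (G.lhs p).length) (Finset.mem_univ p)

/-- Productions of the simulating context-free grammar: shift a nonterminal into the buffer
(label `none`), or complete the left-hand side of `p` and rewrite (label `some p`). -/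
def SimRule : Option G.P × AnnSymbol G.N G.maxLhs × List (AnnSymbol G.N G.maxLhs ⊕ T) → Prop
  | (none, B, c) => B.2.2.1 = B.2.1.1 ++ [B.1] ∧ c = []
  | (some p, B, c) => B.2.1.1 ++ [B.1] = G.lhs p ∧ Chain [] c B.2.2.1 ∧ erase c = G.rhs p

instance finite_buffer (N : Type) [Finite N] (K : ℕ) : Finite (Buffer N K) :=
  (List.finite_length_le N K).to_subtype

theorem finite_simRule [Finite T] : Finite {x // G.SimRule x} := by
  let M := Finset.univ.sup fun p => (G.rhs p).length
  have hM : ∀ p, (G.rhs p).length ≤ M := fun p =>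
    Finset.le_sup (f := fun p => (G.rhs p).length) (Finset.mem_univ p)
  refine Set.Finite.to_subtype (s := {x | G.SimRule x}) ?_
  refine (Set.finite_univ.prod (Set.finite_univ.prod (List.finite_length_le _ M))).subset ?_
  rintro ⟨_ | p, B, c⟩ hx
  · simp [hx.2]
  · have := congrArg List.length hx.2.2
    have h := hM p
    simp only [erase, List.length_map] at this
    simp [this, h]

/-- The context-free grammar simulating the leftmost derivations of `G`. -/
noncomputable def simGrammar [Finite T] (acc : Set (Set {x // G.SimRule x})) : OmegaPSG T where
  N := AnnSymbol G.N G.maxLhs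
  fintypeN := Fintype.ofFinite _
  P := {x // G.SimRule x}
  fintypeP := @Fintype.ofFinite _ G.finite_simRule
  lhs x := [x.1.2.1]
  lhs_ne _ := List.cons_ne_nil _ _
  rhs x := x.1.2.2
  start := (G.start, ⟨[], Nat.zero_le _⟩, ⟨[], Nat.zero_le _⟩)
  acc := acc

/-- Leftmost steps of the simulating grammar. -/
def SimStep (r : {x // G.SimRule x}) (x y : List (AnnSymbol G.N G.maxLhs ⊕ T)) : Prop :=
  ∃ (u : List T) (v : List (AnnSymbol G.N G.maxLhs ⊕ T)),
    x = u.map Sum.inr ++ Sum.inl r.1.2.1 :: v ∧ y = u.map Sum.inr ++ (r.1.2.2 ++ v)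

theorem simGrammar_lstep_iff [Finite T] {acc : Set (Set {x // G.SimRule x})}
    {r : {x // G.SimRule x}} {x y : List (AnnSymbol G.N G.maxLhs ⊕ T)} :
    (G.simGrammar acc).LStep r x y ↔ G.SimStep r x y := by
  constructor
  · exact fun h => h.exists_map_inr
  · rintro ⟨u, v, rfl, rfl⟩
    exact LStep.of_map_inr (G := G.simGrammar acc) u v

section Soundness

/-- `x` is a terminal word followed by a chain starting with buffer `w`, and `g` is the sentential
form of `G` it stands for. -/
def Represents (x : List (AnnSymbol G.N G.maxLhs ⊕ T)) (g : List (G.N ⊕ T)) (w : List G.N) : Prop :=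
  w.length ≤ G.maxLhs ∧ ∃ (u : List T) (c : List (AnnSymbol G.N G.maxLhs ⊕ T)),
    x = u.map Sum.inr ++ c ∧ Chain w c [] ∧ g = u.map Sum.inr ++ (w.map Sum.inl ++ erase c)

variable {G}

theorem Represents.normalize {x : List (AnnSymbol G.N G.maxLhs ⊕ T)} {g : List (G.N ⊕ T)}
    {w : List G.N} (h : G.Represents x g w) {u : List T} {B : AnnSymbol G.N G.maxLhs}
    {v : List (AnnSymbol G.N G.maxLhs ⊕ T)} (hx : x = u.map Sum.inr ++ Sum.inl B :: v) :
    B.2.1.1 = w ∧ Chain B.2.2.1 v [] ∧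
      g = u.map Sum.inr ++ (w.map Sum.inl ++ Sum.inl B.1 :: erase v) := by
  obtain ⟨-, u₀, c, rfl, hc, rfl⟩ := h
  induction u₀ generalizing u with
  | nil =>
    simp only [List.map_nil, List.nil_append] at hx ⊢
    subst hx
    induction u generalizing w with
    | nil => exact ⟨hc.1, hc.2, by simp⟩
    | cons a u ih =>
      obtain ⟨rfl, hc⟩ := hc
      obtain ⟨h₁, h₂, h₃⟩ := ih hc
      exact ⟨h₁, h₂, by simp_all [erase]⟩
  | cons a u₀ ih =>
    cases u with
    | nil => simp at hx
    | cons b u =>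
      simp only [List.map_cons, List.cons_append, List.cons.injEq, Sum.inr.injEq] at hx
      obtain ⟨rfl, hx⟩ := hx
      obtain ⟨h₁, h₂, h₃⟩ := ih hx
      exact ⟨h₁, h₂, by simp [h₃]⟩

theorem Represents.step
    {x x' : List (AnnSymbol G.N G.maxLhs ⊕ T)} {g : List (G.N ⊕ T)} {w : List G.N}
    (h : G.Represents x g w) {r : {x // G.SimRule x}} (hr : G.SimStep r x x') :
    termPrefix g = termPrefix x ∧ ∃ g' w', G.Represents x' g' w' ∧
      ((r.1.1 = none ∧ g' = g ∧ w'.length = w.length + 1) ∨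
        ∃ p, r.1.1 = some p ∧ G.LStep p g g') := by
  obtain ⟨⟨o, B, c⟩, hrule⟩ := r
  obtain ⟨u, v, hx, hx'⟩ := hr
  obtain ⟨hw, hv, hg⟩ := h.normalize hx
  have hg' : g = u.map Sum.inr ++ ((w ++ [B.1]).map Sum.inl ++ erase v) := by simp [hg]
  refine ⟨?_, ?_⟩
  · rw [hg', hx, termPrefix_map_inr_append, termPrefix_map_inr_append,
      termPrefix_map_inl_append (by simp)]
    rfl
  · cases o with
    | none =>
      obtain ⟨hB, rfl⟩ := hrule
      exact ⟨g, B.2.2.1, ⟨B.2.2.2, u, v, hx', hv, by rw [hB, hw, hg']⟩,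
        Or.inl ⟨rfl, rfl, by rw [hB, ← hw, List.length_append, List.length_singleton]⟩⟩
    | some p =>
      obtain ⟨hB, hc, he⟩ := hrule
      refine ⟨u.map Sum.inr ++ (G.rhs p ++ erase v), [],
        ⟨Nat.zero_le _, u, c ++ v, hx', hc.append hv, by simp [← he]⟩, Or.inr ⟨p, rfl, ?_⟩⟩
      rw [hg', ← hw, hB]
      exact LStep.of_map_inr u _

/-- Removing the stuttering steps of a sequence whose proper steps occur infinitely often. -/
theorem eq_comp_nth_count {X : Type*} {g : ℕ → X} {A : ℕ → Prop} [DecidablePred A]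
    (hA : (Set.ofPred A).Infinite) (hg : ∀ n, ¬ A n → g (n + 1) = g n) (i : ℕ) :
    g (Nat.nth A (Nat.count A i)) = g i := by
  have key : ∀ k, i + k ≤ Nat.nth A (Nat.count A i) → g (i + k) = g i := by
    intro k
    induction k with
    | zero => simp
    | succ k ih =>
      intro hk
      rw [← ih (by omega), ← add_assoc]
      refine hg _ fun hAk => ?_
      have h₁ : Nat.count A i < Nat.count A (i + k + 1) := by
        rw [Nat.count_succ, if_pos hAk]
        exact Nat.lt_succ_of_le (Nat.count_monotone A (Nat.le_add_right i k))
      have h₂ := (Nat.lt_nth_iff_count_lt hA).1 h₁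
      omega
  have hle : i ≤ Nat.nth A (Nat.count A i) := by
    by_contra hlt
    have := (Nat.lt_nth_iff_count_lt hA).2 (not_le.1 hlt)
    omega
  obtain ⟨k, hk⟩ := Nat.exists_eq_add_of_le hle
  rw [hk]
  exact key k hk.ge

theorem exists_lderives_of_simGrammar [Finite T] {acc : Set (Set {x // G.SimRule x})}
    {u : ℕ → T} {s : ℕ → List (AnnSymbol G.N G.maxLhs ⊕ T)} {d : ℕ → {x // G.SimRule x}}
    (h : (G.simGrammar acc).LDerives u s d) :
    ∃ s' d', G.LDerives u s' d' ∧ ∀ p, p ∈ Set.range d' ↔ ∃ n, (d n).1.1 = some p := by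
  classical
  obtain ⟨h0, hlstep, hlen, hmatch⟩ := h
  have hstep : ∀ n, G.SimStep (d n) (s n) (s (n + 1)) := fun n =>
    G.simGrammar_lstep_iff.1 (hlstep n)
  have hex : ∀ (n : ℕ) (z : {z : List (G.N ⊕ T) × List G.N // G.Represents (s n) z.1 z.2}),
      ∃ z' : {z : List (G.N ⊕ T) × List G.N // G.Represents (s (n + 1)) z.1 z.2},
      ((d n).1.1 = none ∧ z'.1.1 = z.1.1 ∧ z'.1.2.length = z.1.2.length + 1) ∨
        ∃ p, (d n).1.1 = some p ∧ G.LStep p z.1.1 z'.1.1 := by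
    intro n z
    obtain ⟨-, g', w', hr, hgw⟩ := z.2.step (hstep n)
    exact ⟨⟨(g', w'), hr⟩, hgw⟩
  choose next hnext using hex
  have hinit : G.Represents (s 0) [Sum.inl G.start] [] :=
    ⟨Nat.zero_le _, [], s 0, rfl, by rw [h0]; exact ⟨rfl, rfl⟩, by rw [h0]; rfl⟩
  let z : ∀ n, {z : List (G.N ⊕ T) × List G.N // G.Represents (s n) z.1 z.2} := fun n =>
    Nat.rec ⟨([Sum.inl G.start], []), hinit⟩ (fun n z => next n z) n
  have hz : ∀ n, ((d n).1.1 = none ∧ (z (n + 1)).1.1 = (z n).1.1 ∧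
      (z (n + 1)).1.2.length = (z n).1.2.length + 1) ∨
        ∃ p, (d n).1.1 = some p ∧ G.LStep p (z n).1.1 (z (n + 1)).1.1 := fun n => hnext n (z n)
  have hterm : ∀ n, termPrefix (z n).1.1 = termPrefix (s n) := fun n => ((z n).2.step (hstep n)).1
  let A : ℕ → Prop := fun n => (d n).1.1 ≠ none
  have hstutter : ∀ n, ¬ A n → (z (n + 1)).1.1 = (z n).1.1 := by
    intro n hn
    rcases hz n with h | ⟨p, hp, -⟩
    · exact h.2.1
    · exact absurd (by simp [A, hp]) hn
  have hA : (Set.ofPred A).Infinite := by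
    refine Set.infinite_of_not_bddAbove ?_
    rintro ⟨m, hm⟩
    have hlong : ∀ k, (z (m + 1 + k)).1.2.length = (z (m + 1)).1.2.length + k := by
      intro k
      induction k with
      | zero => rfl
      | succ k ih =>
        rcases hz (m + 1 + k) with h | ⟨p, hp, -⟩
        · rw [← add_assoc, h.2.2, ih, add_assoc]
        · have : m + 1 + k ≤ m := hm (show A _ by simp [A, hp])
          omega
    have h₁ := hlong (G.maxLhs + 1)
    have h₂ := (z (m + 1 + (G.maxLhs + 1))).2.1
    omega
  have hcount := eq_comp_nth_count (g := fun n => (z n).1.1) hA hstutter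
  have happly : ∀ n, ∃ p, (d (Nat.nth A n)).1.1 = some p ∧
      G.LStep p (z (Nat.nth A n)).1.1 (z (Nat.nth A n + 1)).1.1 := by
    intro n
    rcases hz (Nat.nth A n) with h | h
    · exact absurd h.1 (Nat.nth_mem_of_infinite hA n)
    · exact h
  choose d' hd' hd'step using happly
  refine ⟨fun n => (z (Nat.nth A n)).1.1, d', ⟨?_, ?_, ?_, ?_⟩, ?_⟩
  · exact (congrArg (fun n => (z (Nat.nth A n)).1.1) (Nat.count_zero A)).symm.trans (hcount 0)
  · intro n
    have h := hcount (Nat.nth A n + 1)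
    rw [Nat.count_succ, if_pos (Nat.nth_mem_of_infinite hA n), Nat.count_nth_of_infinite hA] at h
    simp only [h]
    exact hd'step n
  · intro n
    obtain ⟨i, hi⟩ := hlen n
    refine ⟨Nat.count A i, ?_⟩
    change n ≤ (termPrefix (z (Nat.nth A (Nat.count A i))).1.1).length
    rw [hcount i, hterm]
    exact hi
  · intro i
    rw [hterm]
    exact hmatch _
  · intro p
    constructor
    · rintro ⟨n, rfl⟩
      exact ⟨_, hd' n⟩
    · rintro ⟨n, hn⟩
      refine ⟨Nat.count A n, ?_⟩
      have h := hd' (Nat.count A n)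
      rw [Nat.nth_count (show A n by simp [A, hn]), hn] at h
      exact (Option.some_injective _ h).symm

end Soundness

section Completeness

variable {G}

/-- The nonterminals consumed by the first step at or after `i` that leaves fewer than `m` trailing
symbols untouched, up to the suffix of length `m`; step `t` leaves `r t` symbols untouched. -/
noncomputable def consumed (d : ℕ → G.P) (r : ℕ → ℕ) (i m : ℕ) : Buffer G.N G.maxLhs :=
  open Classical in
  if h : ∃ t, i ≤ t ∧ r t < m then
    ⟨(G.lhs (d (Nat.find h))).take (r (Nat.find h) + (G.lhs (d (Nat.find h))).length - m),
      (List.length_take_le' _ _).trans (G.length_lhs_le _)⟩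
  else ⟨[], Nat.zero_le _⟩

theorem consumed_of_lt {d : ℕ → G.P} {r : ℕ → ℕ} {i m : ℕ} (h : r i < m) :
    (consumed d r i m).1 = (G.lhs (d i)).take (r i + (G.lhs (d i)).length - m) := by
  classical
  have hex : ∃ t, i ≤ t ∧ r t < m := ⟨i, le_rfl, h⟩
  have hfind : Nat.find hex = i :=
    (Nat.find_eq_iff hex).2 ⟨⟨le_rfl, h⟩, fun n hn hn' => absurd hn'.1 (not_le.2 hn)⟩
  rw [consumed, dif_pos hex]
  simp only [hfind]

theorem consumed_succ {d : ℕ → G.P} {r : ℕ → ℕ} {i m : ℕ} (h : m ≤ r i) :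
    consumed d r i m = consumed d r (i + 1) m := by
  have hiff : ∀ t, (i ≤ t ∧ r t < m) ↔ (i + 1 ≤ t ∧ r t < m) := by
    intro t
    rcases eq_or_ne i t with rfl | hne
    · simp [h]
    · simp [lt_iff_le_and_ne, hne]
  classical
  by_cases hex : ∃ t, i ≤ t ∧ r t < m
  · have hex' : ∃ t, i + 1 ≤ t ∧ r t < m := (exists_congr hiff).1 hex
    have hfind : Nat.find hex = Nat.find hex' := Nat.find_congr' (hiff _)
    rw [consumed, consumed, dif_pos hex, dif_pos hex']
    simp only [hfind]
  · have hex' : ¬ ∃ t, i + 1 ≤ t ∧ r t < m := fun h => hex ((exists_congr hiff).2 h)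
    rw [consumed, consumed, dif_neg hex, dif_neg hex']

theorem consumed_of_forall {d : ℕ → G.P} {r : ℕ → ℕ} {i m : ℕ} (h : ∀ t, i ≤ t → m ≤ r t) :
    (consumed d r i m).1 = [] := by
  rw [consumed, dif_neg]
  rintro ⟨t, ht, hm⟩
  exact absurd (h t ht) (not_le.2 hm)

/-- The `i`-th step of the derivation rewrites the left-hand side between `u i` and `v i`. -/
def FactorsAs (s : ℕ → List (G.N ⊕ T)) (d : ℕ → G.P) (u : ℕ → List T)
    (v : ℕ → List (G.N ⊕ T)) : Prop :=
  ∀ i, s i = (u i).map Sum.inr ++ ((G.lhs (d i)).map Sum.inl ++ v i) ∧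
    s (i + 1) = (u i).map Sum.inr ++ (G.rhs (d i) ++ v i)

theorem length_le_of_inr_cons {N : Type} {u : List T} {w : List N} {v y l : List (N ⊕ T)} {a : T}
    (h : u.map Sum.inr ++ (w.map Sum.inl ++ v) = y ++ Sum.inr a :: l) (hv : v.length ≤ l.length) :
    w.length + v.length ≤ l.length := by
  rcases List.append_eq_append_iff.1 h with ⟨b, -, hb⟩ | ⟨b, -, hb⟩
  · rcases List.append_eq_append_iff.1 hb with ⟨c, -, rfl⟩ | ⟨c, hc, hl⟩
    · rw [List.length_append, List.length_cons] at hv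
      omega
    · rcases c with - | ⟨x, c⟩
      · rw [List.nil_append] at hl
        simp [← hl] at hv
      · have hx : x ∈ w.map Sum.inl := by simp [hc]
        simp only [List.cons_append, List.cons.injEq] at hl
        simp [← hl.1] at hx
  · rcases b with - | ⟨x, b⟩
    · rcases w with - | ⟨A, w⟩
      · simp only [List.map_nil, List.nil_append] at hb
        simp [← hb] at hv
      · simp at hb
    · simp only [List.cons_append, List.cons.injEq] at hb
      simp [hb.2]

theorem length_le_of_map_inr_append {N : Type} {u u' : List T} {w : List N} {v x : List (N ⊕ T)}
    (h : u.map Sum.inr ++ (w.map Sum.inl ++ v) = u'.map Sum.inr ++ x) (hw : w ≠ []) :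
    w.length + v.length ≤ x.length := by
  obtain ⟨A, w, rfl⟩ := List.exists_cons_of_ne_nil hw
  rcases List.append_eq_append_iff.1 h with ⟨b, hu, hb⟩ | ⟨b, -, hb⟩
  · rcases b with - | ⟨y, b⟩
    · have := congrArg List.length hb
      simp at this ⊢
      omega
    · have hy : y ∈ u'.map Sum.inr := by simp [hu]
      simp only [List.map_cons, List.cons_append, List.cons.injEq] at hb
      simp [← hb.1] at hy
  · simp [hb]
    omega

variable {s : ℕ → List (G.N ⊕ T)} {d : ℕ → G.P} {u : ℕ → List T} {v : ℕ → List (G.N ⊕ T)}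

theorem FactorsAs.consumed_terminal (h : FactorsAs s d u v) {i : ℕ} {a : T} {l : List (G.N ⊕ T)}
    (hl : Sum.inr a :: l <:+ s i) :
    (consumed d (fun t => (v t).length) i (l.length + 1)).1 = [] ∧
      (consumed d (fun t => (v t).length) i l.length).1 = [] := by
  have hnow : ∀ {i}, Sum.inr a :: l <:+ s i → (v i).length < l.length + 1 →
      (consumed d (fun t => (v t).length) i (l.length + 1)).1 = [] ∧
        (consumed d (fun t => (v t).length) i l.length).1 = [] := by
    rintro i ⟨y, hy⟩ hi
    have hle := length_le_of_inr_cons ((h i).1.symm.trans hy.symm) (Nat.le_of_lt_succ hi)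
    have hpos := List.length_pos_iff.2 (G.lhs_ne (d i))
    rw [consumed_of_lt hi, consumed_of_lt (by omega)]
    constructor <;> · rw [List.take_eq_nil_iff]; left; omega
  by_cases hex : ∃ n, (v (i + n)).length < l.length + 1
  · obtain ⟨n, hn⟩ := hex
    induction n generalizing i with
    | zero => exact hnow hl hn
    | succ n ih =>
      by_cases hi : (v i).length < l.length + 1
      · exact hnow hl hi
      · rw [consumed_succ (i := i) (by omega), consumed_succ (i := i) (m := l.length) (by omega)]
        refine ih (List.IsSuffix.trans ?_ ⟨_, ((h i).2.trans (List.append_assoc _ _ _).symm).symm⟩)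
          (by rwa [add_assoc, add_comm 1 n])
        exact List.suffix_of_suffix_length_le hl
          ⟨_, ((h i).1.trans (List.append_assoc _ _ _).symm).symm⟩ (by simp; omega)
  · push Not at hex
    have hle : ∀ t, i ≤ t → l.length + 1 ≤ (v t).length := fun t ht => by
      simpa [Nat.add_sub_cancel' ht] using hex (t - i)
    exact ⟨consumed_of_forall hle, consumed_of_forall fun t ht => (Nat.le_succ _).trans (hle t ht)⟩

theorem FactorsAs.consumed_front (h : FactorsAs s d u v) {i : ℕ} {u' : List T}
    {x : List (G.N ⊕ T)} (hx : s i = u'.map Sum.inr ++ x) :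
    (consumed d (fun t => (v t).length) i x.length).1 = [] := by
  have hle := length_le_of_map_inr_append ((h i).1.symm.trans hx) (G.lhs_ne (d i))
  have hpos := List.length_pos_iff.2 (G.lhs_ne (d i))
  rw [consumed_of_lt (by omega), List.take_eq_nil_iff]
  left
  omega

/-- The simulating sentential form after shifting `j` symbols of the `i`-th left-hand side. -/
noncomputable def simForm (d : ℕ → G.P) (u : ℕ → List T) (v : ℕ → List (G.N ⊕ T)) (i j : ℕ) :
    List (AnnSymbol G.N G.maxLhs ⊕ T) :=
  (u i).map Sum.inr ++ annotate (consumed d (fun t => (v t).length) i)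
    (((G.lhs (d i)).drop j).map Sum.inl ++ v i)

theorem FactorsAs.simForm_zero (h : FactorsAs s d u v) (i : ℕ) :
    simForm d u v i 0 = annotate (consumed d (fun t => (v t).length) i) (s i) := by
  rw [(h i).1, annotate_append, annotate_map_inr]
  rfl

theorem FactorsAs.termPrefix_simForm (h : FactorsAs s d u v) {i j : ℕ}
    (hj : j < (G.lhs (d i)).length) : termPrefix (simForm d u v i j) = termPrefix (s i) := by
  rw [(h i).1, simForm, termPrefix_map_inr_append, termPrefix_map_inr_append,
    termPrefix_map_inl_append (G.lhs_ne _), List.drop_eq_getElem_cons hj]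
  rfl

theorem simForm_eq_cons {i j : ℕ} (hj : j < (G.lhs (d i)).length) :
    ∃ B : AnnSymbol G.N G.maxLhs,
      B.1 = (G.lhs (d i))[j] ∧ B.2.1.1 = (G.lhs (d i)).take j ∧
      B.2.2 = consumed d (fun t => (v t).length) i
        ((G.lhs (d i)).length - (j + 1) + (v i).length) ∧
      simForm d u v i j = (u i).map Sum.inr ++ Sum.inl B ::
        annotate (consumed d (fun t => (v t).length) i)
          (((G.lhs (d i)).drop (j + 1)).map Sum.inl ++ v i) := by
  refine ⟨((G.lhs (d i))[j], consumed d (fun t => (v t).length) i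
    ((G.lhs (d i)).length - (j + 1) + (v i).length + 1), consumed d (fun t => (v t).length) i
    ((G.lhs (d i)).length - (j + 1) + (v i).length)), rfl, ?_, rfl, ?_⟩
  · rw [consumed_of_lt (by omega)]
    congr 1
    omega
  · simp only [simForm, List.drop_eq_getElem_cons hj, List.map_cons, List.cons_append, annotate,
      List.length_append, List.length_map, List.length_drop]

theorem exists_shift {i j : ℕ} (hj : j + 1 < (G.lhs (d i)).length) :
    ∃ r : {x // G.SimRule x}, r.1.1 = none ∧
      G.SimStep r (simForm d u v i j) (simForm d u v i (j + 1)) := by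
  obtain ⟨B, hB, hB₁, hB₂, hform⟩ := simForm_eq_cons (u := u) (v := v) (Nat.lt_of_succ_lt hj)
  have hrule : G.SimRule (none, B, []) := by
    refine ⟨?_, rfl⟩
    rw [hB, hB₁, hB₂, consumed_of_lt (by omega), List.take_append_getElem]
    congr 1
    omega
  exact ⟨⟨_, hrule⟩, rfl, u i, _, hform, rfl⟩

theorem FactorsAs.exists_rewrite (h : FactorsAs s d u v) {i j : ℕ}
    (hj : j + 1 = (G.lhs (d i)).length) :
    ∃ r : {x // G.SimRule x}, r.1.1 = some (d i) ∧
      G.SimStep r (simForm d u v i j) (simForm d u v (i + 1) 0) := by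
  obtain ⟨B, hB, hB₁, hB₂, hform⟩ := simForm_eq_cons (u := u) (v := v) (Nat.lt_of_succ_le hj.le)
  let q := consumed d (fun t => (v t).length) (i + 1)
  have hrule : G.SimRule
      (some (d i), B, annotate (fun m => q (m + (v i).length)) (G.rhs (d i))) := by
    refine ⟨?_, ?_, erase_annotate _ _⟩
    · rw [hB, hB₁, List.take_append_getElem, List.take_of_length_le hj.ge]
    · have hc : Chain (q ((G.rhs (d i)).length + (v i).length)).1
          (annotate (fun m => q (m + (v i).length)) (G.rhs (d i))) (q (0 + (v i).length)).1 := by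
        refine chain_annotate (q := fun m => q (m + (v i).length)) fun y a l' hl => ?_
        have := h.consumed_terminal (i := i + 1) (a := a) (l := l' ++ v i)
          ⟨(u i).map Sum.inr ++ y, by simp [(h i).2, hl]⟩
        simpa [q, Nat.add_right_comm] using this
      have hfront := h.consumed_front (h i).2
      rw [List.length_append] at hfront
      rw [hfront] at hc
      rw [hB₂, consumed_succ (by simp; omega)]
      simpa [q, ← hj] using hc
  have hv : annotate (consumed d (fun t => (v t).length) i) (v i) = annotate q (v i) :=
    annotate_congr fun m hm => consumed_succ hm
  rw [List.drop_of_length_le hj.ge, List.map_nil, List.nil_append, hv] at hform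
  refine ⟨⟨_, hrule⟩, rfl, u i, _, hform, ?_⟩
  rw [h.simForm_zero, (h i).2, annotate_append, annotate_map_inr, annotate_append]

/-- A traversal of the blocks `{i} × [0, len i)` in lexicographic order. -/
theorem exists_block_traversal {len : ℕ → ℕ} (hlen : ∀ i, 0 < len i) :
    ∃ c : ℕ → ℕ × ℕ, c 0 = (0, 0) ∧
      (∀ n, ((c n).2 + 1 < len (c n).1 ∧ c (n + 1) = ((c n).1, (c n).2 + 1)) ∨
        ((c n).2 + 1 = len (c n).1 ∧ c (n + 1) = ((c n).1 + 1, 0))) ∧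
      ∀ i j, j < len i → ∃ n, c n = (i, j) := by
  let next : ℕ × ℕ → ℕ × ℕ := fun z => if z.2 + 1 < len z.1 then (z.1, z.2 + 1) else (z.1 + 1, 0)
  let c : ℕ → ℕ × ℕ := fun n => next^[n] (0, 0)
  have hc : ∀ n, c (n + 1) = next (c n) := fun n => Function.iterate_succ_apply' _ _ _
  have hlt : ∀ n, (c n).2 < len (c n).1 := by
    intro n
    induction n with
    | zero => exact hlen 0
    | succ n ih =>
      rw [hc]
      by_cases h : (c n).2 + 1 < len (c n).1
      · simp [next, h]
      · simp [next, h, hlen]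
  have hrow : ∀ i, (∃ n, c n = (i, 0)) → ∀ j, j < len i → ∃ n, c n = (i, j) := by
    intro i h0 j
    induction j with
    | zero => exact fun _ => h0
    | succ j ih =>
      intro hj
      obtain ⟨n, hn⟩ := ih (Nat.lt_of_succ_lt hj)
      exact ⟨n + 1, by simp [hc, hn, next, hj]⟩
  refine ⟨c, rfl, fun n => ?_, fun i => hrow i ?_⟩
  · rw [hc]
    by_cases h : (c n).2 + 1 < len (c n).1
    · exact Or.inl ⟨h, by simp [next, h]⟩
    · exact Or.inr ⟨by have := hlt n; omega, by simp [next, h]⟩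
  · induction i with
    | zero => exact ⟨0, rfl⟩
    | succ i ih =>
      obtain ⟨n, hn⟩ := hrow i ih (len i - 1) (Nat.sub_lt (hlen i) one_pos)
      exact ⟨n + 1, by simp [hc, hn, next]; omega⟩

theorem exists_simGrammar_lderives [Finite T] {acc : Set (Set {x // G.SimRule x})} {w : ℕ → T}
    (h : G.LDerives w s d) :
    ∃ s' d', (G.simGrammar acc).LDerives w s' d' ∧
      ∀ p, p ∈ Set.range d ↔ ∃ n, (d' n).1.1 = some p := by
  obtain ⟨h0, hstep, hlen, hmatch⟩ := h
  choose u v huv using fun i => (hstep i).exists_map_inr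
  have hf : FactorsAs s d u v := huv
  obtain ⟨c, hc0, hc, hhit⟩ := exists_block_traversal
    (len := fun i => (G.lhs (d i)).length) fun i => List.length_pos_iff.2 (G.lhs_ne _)
  have hlt : ∀ n, (c n).2 < (G.lhs (d (c n).1)).length := fun n => by
    rcases hc n with h | h <;> omega
  have hmicro : ∀ n, ∃ r : {x // G.SimRule x},
      (∀ p, r.1.1 = some p → p = d (c n).1) ∧
      ((c n).2 + 1 = (G.lhs (d (c n).1)).length → r.1.1 = some (d (c n).1)) ∧
      G.SimStep r (simForm d u v (c n).1 (c n).2)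
        (simForm d u v (c (n + 1)).1 (c (n + 1)).2) := by
    intro n
    rcases hc n with ⟨hj, hn⟩ | ⟨hj, hn⟩
    · obtain ⟨r, hr, hs⟩ := exists_shift (u := u) (v := v) hj
      exact ⟨r, by simp [hr], fun h => by omega, by rw [hn]; exact hs⟩
    · obtain ⟨r, hr, hs⟩ := hf.exists_rewrite hj
      exact ⟨r, by simp [hr], fun _ => hr, by rw [hn]; exact hs⟩
  choose d' hd' hd'' hs' using hmicro
  have hterm : ∀ n, termPrefix (simForm d u v (c n).1 (c n).2) = termPrefix (s (c n).1) :=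
    fun n => hf.termPrefix_simForm (hlt n)
  refine ⟨fun n => simForm d u v (c n).1 (c n).2, d', ⟨?_, fun n => G.simGrammar_lstep_iff.2 (hs' n), ?_, ?_⟩,
    fun p => ⟨?_, ?_⟩⟩
  · have h₁ := hf.consumed_front (u' := []) (x := [Sum.inl G.start]) h0
    have h₂ : (consumed d (fun t => (v t).length) 0 0).1 = [] :=
      consumed_of_forall fun _ _ => Nat.zero_le _
    simp only [hc0, hf.simForm_zero, h0, annotate, List.length_nil]
    exact congrArg (fun B => [Sum.inl B]) (Prod.ext rfl (Prod.ext (Subtype.ext h₁) (Subtype.ext h₂)))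
  · intro n
    obtain ⟨i, hi⟩ := hlen n
    obtain ⟨m, hm⟩ := hhit i 0 (List.length_pos_iff.2 (G.lhs_ne _))
    refine ⟨m, hi.trans_eq (congrArg List.length ?_)⟩
    exact ((hterm m).trans (by rw [hm])).symm
  · intro n
    exact (hterm n).symm ▸ hmatch _
  · rintro ⟨i, rfl⟩
    have hpos := List.length_pos_iff.2 (G.lhs_ne (d i))
    obtain ⟨n, hn⟩ := hhit i ((G.lhs (d i)).length - 1) (Nat.sub_lt hpos one_pos)
    refine ⟨n, ?_⟩
    have := hd'' n
    rw [hn] at this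
    exact this (Nat.sub_add_cancel hpos)
  · rintro ⟨n, hn⟩
    exact ⟨_, (hd' n p hn).symm⟩

end Completeness

/-- Acceptance sets of the simulating grammar that reflect a `ran`-acceptance mode of `G`. -/
def simAcc : AccRho → Set (Set {x // G.SimRule x})
  | .cap => {X | ∃ F ∈ G.acc, X = {r | ∃ p ∈ F, r.1.1 = some p}}
  | _ => {X | {p | ∃ r ∈ X, r.1.1 = some p} ∈ G.acc}

variable {G} in
theorem isAccepting_simAcc_iff {ρ : AccRho} (hρ : ρ = .cap ∨ ρ = .eq) {d : ℕ → G.P}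
    {d' : ℕ → {x // G.SimRule x}} (h : ∀ p, p ∈ Set.range d ↔ ∃ n, (d' n).1.1 = some p) :
    IsAccepting .ran ρ (G.simAcc ρ) d' ↔ IsAccepting .ran ρ G.acc d := by
  rcases hρ with rfl | rfl
  · constructor
    · rintro ⟨-, ⟨F, hF, rfl⟩, -, ⟨n, rfl⟩, p, hp, hn⟩
      exact ⟨F, hF, p, (h p).2 ⟨n, hn⟩, hp⟩
    · rintro ⟨F, hF, p, hpd, hp⟩
      obtain ⟨n, hn⟩ := (h p).1 hpd
      exact ⟨_, ⟨F, hF, rfl⟩, d' n, ⟨n, rfl⟩, p, hp, hn⟩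
  · have hran : {p | ∃ r ∈ Set.range d', r.1.1 = some p} = Set.range d := by
      ext p
      rw [h p]
      exact Set.exists_range_iff
    constructor
    · rintro ⟨X, hX, rfl⟩
      exact ⟨_, hX, hran.symm⟩
    · rintro ⟨F, hF, rfl⟩
      refine ⟨_, ?_, rfl⟩
      change {p | ∃ r ∈ Set.range d', r.1.1 = some p} ∈ G.acc
      rw [hran]
      exact hF

theorem lang_simGrammar [Finite T] {ρ : AccRho} (hρ : ρ = .cap ∨ ρ = .eq) :
    (G.simGrammar (G.simAcc ρ)).Lang .ran ρ .l = G.Lang .ran ρ .l := by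
  ext w
  constructor
  · rintro ⟨s, d, h0, hstep, hlen, hmatch, hacc⟩
    obtain ⟨s', d', ⟨h0', hstep', hlen', hmatch'⟩, hd⟩ :=
      exists_lderives_of_simGrammar ⟨h0, hstep, hlen, hmatch⟩
    exact ⟨s', d', h0', hstep', hlen', hmatch', (isAccepting_simAcc_iff hρ hd).1 hacc⟩
  · rintro ⟨s, d, h0, hstep, hlen, hmatch, hacc⟩
    obtain ⟨s', d', ⟨h0', hstep', hlen', hmatch'⟩, hd⟩ :=
      exists_simGrammar_lderives (acc := G.simAcc ρ) ⟨h0, hstep, hlen, hmatch⟩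
    exact ⟨s', d', h0', hstep', hlen', hmatch', (isAccepting_simAcc_iff hρ hd).2 hacc⟩

end OmegaPSG

end OmegaFormal

/-- Theorem: 𝓛_{σ,ρ,l}(ω-CSG) ⊆ 𝓛_{σ,ρ,l}(ω-CFG) for (σ,ρ) ∈ {(ran,⊓), (ran,=)}. -/
theorem csg_l_subset_cfg_l (T : Type) [Fintype T] (σ : AccSigma) (ρ : AccRho)
    (h : (σ, ρ) = (AccSigma.ran, AccRho.cap) ∨ (σ, ρ) = (AccSigma.ran, AccRho.eq)) :
    GLang T OmegaPSG.IsCSG σ ρ DerivMode.l ⊆ GLang T OmegaPSG.IsCFG σ ρ DerivMode.l := by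
  obtain ⟨rfl, hρ⟩ : σ = .ran ∧ (ρ = .cap ∨ ρ = .eq) := by
    rcases h with h | h <;> cases h <;> simp
  rintro L ⟨G, -, rfl⟩
  exact ⟨G.simGrammar (G.simAcc ρ), fun _ => rfl, (G.lang_simGrammar hρ).symm⟩
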